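/- arXiv:1812.11945 — 8 statements merged into one kernel-verified Lean document; each statement's English description precedes it below -/
import Mathlib

section
/- Let p = 3, let q be a power of 3, and let n ≥ 2 and d ≥ 1 be integers. The polynomial 𝖤_{n,d} ∈ 𝔽_q[x] is a Dembowski–Ostrom polynomial if and only if one of the following holds: (i) n ∈ {2, 3, 5, 6} and d = (3^α + 1)·3^k for some α, k ≥ 0; (ii) n = 4 and d = ((3^α + 1)/2)·3^k for some α, k ≥ 0; (iii) n = 7 and d = 2·3^k for some k ≥ 0; (iv) n = 10 and d = 2·3^k; (v) n = 13 and d = 2·3^k; (vi) n = 15 and d = 4·3^k; (vii) n = 19 and d = 2·3^k. -/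
open Polynomial Finset

/-- A Dembowski–Ostrom polynomial in characteristic `p`: every exponent occurring with a
nonzero coefficient is of the form `p^i + p^j` for nonnegative integers `i, j`. -/
def IsDOPoly (p : ℕ) {F : Type*} [Field F] (f : F[X]) : Prop :=
  ∀ k ∈ f.support, ∃ i j : ℕ, k = p ^ i + p ^ j

/-- The integer coefficient `(n/(n-i)) * binom(n-i, i)` of the reversed Dickson
polynomial of the first kind (the natural division is exact). -/
def dicksonCoeff (n i : ℕ) : ℕ := n * (n - i).choose i / (n - i)

/-- `𝒟_{n,d} = D_n(1, x^d) - D_n(1, 0)` over `F`, i.e.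
`∑_{i=1}^{⌊n/2⌋} (n/(n-i))·binom(n-i,i)·(-1)^i·x^{d·i}`. -/
noncomputable def DD (F : Type*) [Field F] (n d : ℕ) : F[X] :=
  ∑ i ∈ Finset.Icc 1 (n / 2), C ((-1 : F) ^ i * (dicksonCoeff n i : F)) * X ^ (d * i)

/-- `𝖤_{n,d} = E_n(1, x^d) - E_n(1, 0)` over `F`, i.e.
`∑_{i=1}^{⌊n/2⌋} binom(n-i,i)·(-1)^i·x^{d·i}`. -/
noncomputable def EE (F : Type*) [Field F] (n d : ℕ) : F[X] :=
  ∑ i ∈ Finset.Icc 1 (n / 2), C ((-1 : F) ^ i * ((n - i).choose i : F)) * X ^ (d * i)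

/-- The reversed Dickson polynomial of the first kind `D_n(a, x)`, as a function on `F`. -/
def revDicksonFst {F : Type*} [Field F] (n : ℕ) (a x : F) : F :=
  ∑ i ∈ Finset.range (n / 2 + 1), (dicksonCoeff n i : F) * (-x) ^ i * a ^ (n - 2 * i)

/-- The reversed Dickson polynomial of the second kind `E_n(a, x)`, as a function on `F`. -/
def revDicksonSnd {F : Type*} [Field F] (n : ℕ) (a x : F) : F :=
  ∑ i ∈ Finset.range (n / 2 + 1), ((n - i).choose i : F) * (-x) ^ i * a ^ (n - 2 * i)

/-- `D_n(1, x)` as a one-variable polynomial over `F`. -/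
noncomputable def revDicksonFstPoly (F : Type*) [Field F] (n : ℕ) : F[X] :=
  ∑ i ∈ Finset.range (n / 2 + 1), C ((-1 : F) ^ i * (dicksonCoeff n i : F)) * X ^ i

/-- `m` is a sum of two powers of `3`. -/
def IsSumTwoPow (m : ℕ) : Prop := ∃ i j : ℕ, m = 3 ^ i + 3 ^ j

theorem IsSumTwoPow.mul_pow {m : ℕ} (h : IsSumTwoPow m) (k : ℕ) : IsSumTwoPow (m * 3 ^ k) := by
  obtain ⟨i, j, rfl⟩ := h
  exact ⟨i + k, j + k, by ring⟩

theorem IsSumTwoPow.of_mul_three {m : ℕ} (h : IsSumTwoPow (m * 3)) : IsSumTwoPow m := by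
  obtain ⟨i, j, h⟩ := h
  rcases i with _ | i <;> rcases j with _ | j <;> simp only [pow_zero, pow_succ] at h
  · omega
  · omega
  · omega
  · exact ⟨i, j, by omega⟩

theorem isSumTwoPow_mul_pow {m k : ℕ} : IsSumTwoPow (m * 3 ^ k) ↔ IsSumTwoPow m := by
  refine ⟨fun h => ?_, fun h => h.mul_pow k⟩
  induction k with
  | zero => simpa using h
  | succ k ih => exact ih (IsSumTwoPow.of_mul_three (by rwa [pow_succ, ← mul_assoc] at h))

theorem IsSumTwoPow.exists_eq_add_one {m : ℕ} (h : IsSumTwoPow m) (hm : ¬ 3 ∣ m) :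
    ∃ a, m = 3 ^ a + 1 := by
  obtain ⟨i, j, rfl⟩ := h
  rcases i with _ | i
  · exact ⟨j, by ring⟩
  · rcases j with _ | j
    · exact ⟨i + 1, by ring⟩
    · exact absurd ⟨3 ^ i + 3 ^ j, by ring⟩ hm

theorem isSumTwoPow_iff_of_lt {m : ℕ} (hm : m < 81) :
    IsSumTwoPow m ↔ ∃ i < 4, ∃ j < 4, m = 3 ^ i + 3 ^ j := by
  constructor
  · rintro ⟨i, j, h⟩
    have key : ∀ t, 3 ^ t < 81 → t < 4 := fun t ht =>
      (Nat.pow_lt_pow_iff_right (by norm_num : 1 < 3)).1 (by simpa using ht)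
    have h1 : 0 < 3 ^ i := by positivity
    have h2 : 0 < 3 ^ j := by positivity
    exact ⟨i, key i (by omega), j, key j (by omega), h⟩
  · rintro ⟨i, -, j, -, h⟩
    exact ⟨i, j, h⟩

theorem not_isSumTwoPow_mul_four {d : ℕ} (hd : ¬ 3 ∣ d) (h : IsSumTwoPow d) :
    ¬ IsSumTwoPow (d * 4) := by
  intro h4
  obtain ⟨a, rfl⟩ := h.exists_eq_add_one hd
  obtain ⟨b, hb⟩ := h4.exists_eq_add_one (by omega)
  have ha : 0 < 3 ^ a := by positivity
  rcases a with _ | _ | a <;> rcases b with _ | _ | b <;>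
    simp only [pow_zero, pow_succ] at ha hb <;> omega

theorem eq_four_of_isSumTwoPow {d : ℕ} (hd : ¬ 3 ∣ d) (h : IsSumTwoPow d)
    (h7 : IsSumTwoPow (d * 7)) : d = 4 := by
  obtain ⟨a, rfl⟩ := h.exists_eq_add_one hd
  obtain ⟨b, hb⟩ := h7.exists_eq_add_one (by omega)
  rcases a with _ | _ | a <;> rcases b with _ | _ | b <;>
    simp only [pow_zero, pow_succ] at hb ⊢ <;> omega

theorem eq_two_of_isSumTwoPow {d : ℕ} (hd : ¬ 3 ∣ d) (h : IsSumTwoPow d)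
    (h2 : IsSumTwoPow (d * 2)) : d = 2 := by
  obtain ⟨a, rfl⟩ := h.exists_eq_add_one hd
  obtain ⟨b, hb⟩ := h2.exists_eq_add_one (by omega)
  have ha : 0 < 3 ^ a := by positivity
  rcases a with _ | a <;> rcases b with _ | b <;>
    simp only [pow_zero, pow_succ] at ha hb ⊢ <;> omega

theorem eq_two_of_isSumTwoPow_two_five {d : ℕ} (hd : ¬ 3 ∣ d) (h2 : IsSumTwoPow (d * 2))
    (h5 : IsSumTwoPow (d * 5)) : d = 2 := by
  obtain ⟨a, ha⟩ := h2.exists_eq_add_one (by omega)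
  obtain ⟨b, hb⟩ := h5.exists_eq_add_one (by omega)
  rcases a with _ | _ | a <;> rcases b with _ | _ | b <;>
    simp only [pow_zero, pow_succ] at ha hb <;> omega

/-- The product of the binomial coefficients of the three lowest ternary digits. -/
def digitChoose (a i : ℕ) : ℕ :=
  (a % 3).choose (i % 3) * ((a / 3 % 3).choose (i / 3 % 3) * (a / 9 % 3).choose (i / 9 % 3))

theorem three_dvd_choose_iff {a i : ℕ} (hi : i < 27) :
    3 ∣ a.choose i ↔ 3 ∣ digitChoose a i := by
  have : Fact (Nat.Prime 3) := ⟨Nat.prime_three⟩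
  have h1 := Choose.choose_modEq_choose_mod_mul_choose_div_nat (p := 3) (n := a) (k := i)
  have h2 := Choose.choose_modEq_choose_mod_mul_choose_div_nat (p := 3) (n := a / 3) (k := i / 3)
  have h3 := Choose.choose_modEq_choose_mod_mul_choose_div_nat (p := 3) (n := a / 9) (k := i / 9)
  have hi0 : i / 9 / 3 = 0 := by omega
  rw [Nat.div_div_eq_div_mul, Nat.div_div_eq_div_mul] at h2
  rw [hi0, Nat.choose_zero_right, mul_one] at h3
  exact (h1.trans ((h2.trans (h3.mul_left _)).mul_left _)).dvd_iff dvd_rfl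

/-- `x ^ i` occurs in the reversed Dickson polynomial `E_n(1, x)` modulo `3`, read off from the
ternary digits (for `i < 27`). -/
def Occurs (n i : ℕ) : Prop := 1 ≤ i ∧ 2 * i ≤ n ∧ ¬ 3 ∣ digitChoose (n - i) i

instance (n i : ℕ) : Decidable (Occurs n i) := by unfold Occurs; infer_instance

/-- Lists of exponents that cannot be simultaneously scaled to sums of two powers of `3`. -/
def obstructions : List (List ℕ) :=
  [[1, 4], [1, 7, 6], [1, 7, 10], [1, 7, 16], [3, 2, 8], [3, 2, 11], [3, 2, 20],
    [2, 5, 11], [2, 5, 20]]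

theorem exists_obstruction_of_lt : ∀ n < 81, 7 ≤ n →
    n ∉ [7, 10, 13, 15, 19] → ∃ l ∈ obstructions, ∀ i ∈ l, Occurs n i := by
  decide +kernel

theorem exists_obstruction {n : ℕ} (hn : 7 ≤ n) (h7 : n ≠ 7) (h10 : n ≠ 10) (h13 : n ≠ 13)
    (h15 : n ≠ 15) (h19 : n ≠ 19) : ∃ l ∈ obstructions, ∀ i ∈ l, Occurs n i := by
  rcases lt_or_ge n 81 with h | h
  · exact exists_obstruction_of_lt n h hn (by simp [*])
  · obtain ⟨l, hl, hl'⟩ := exists_obstruction_of_lt (54 + n % 27) (by omega) (by omega)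
      (by simp only [List.mem_cons, List.not_mem_nil, or_false]; omega)
    refine ⟨l, hl, fun i hi => ?_⟩
    obtain ⟨hi1, hi2, hi3⟩ := hl' i hi
    refine ⟨hi1, by omega, ?_⟩
    have e1 : (54 + n % 27 - i) % 3 = (n - i) % 3 := by omega
    have e2 : (54 + n % 27 - i) / 3 % 3 = (n - i) / 3 % 3 := by omega
    have e3 : (54 + n % 27 - i) / 9 % 3 = (n - i) / 9 % 3 := by omega
    rwa [digitChoose, e1, e2, e3] at hi3

theorem lt_of_mem_obstructions : ∀ l ∈ obstructions, ∀ i ∈ l, i < 27 := by decide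

theorem not_forall_isSumTwoPow_of_mem_obstructions {d : ℕ} (hd : ¬ 3 ∣ d) {l : List ℕ}
    (hl : l ∈ obstructions) : ¬ ∀ i ∈ l, IsSumTwoPow (d * i) := by
  simp only [obstructions, List.mem_cons, List.not_mem_nil, or_false] at hl
  have h3 : IsSumTwoPow (d * 3) → IsSumTwoPow d := IsSumTwoPow.of_mul_three
  rcases hl with rfl | rfl | rfl | rfl | rfl | rfl | rfl | rfl | rfl <;>
    simp only [List.forall_mem_cons, List.not_mem_nil, false_implies, implies_true, and_true,
      mul_one, not_and]
  · exact not_isSumTwoPow_mul_four hd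
  iterate 3
    intro h h'
    rw [eq_four_of_isSumTwoPow hd h h', isSumTwoPow_iff_of_lt (by norm_num)]
    decide
  iterate 3
    intro h h'
    rw [eq_two_of_isSumTwoPow hd (h3 h) h', isSumTwoPow_iff_of_lt (by norm_num)]
    decide
  iterate 2
    intro h h'
    rw [eq_two_of_isSumTwoPow_two_five hd h h', isSumTwoPow_iff_of_lt (by norm_num)]
    decide

theorem isDOPoly_EE_iff {F : Type*} [Field F] [CharP F 3] {n d : ℕ} (hd : 1 ≤ d) :
    IsDOPoly 3 (EE F n d) ↔
      ∀ i, 1 ≤ i → 2 * i ≤ n → ¬ 3 ∣ (n - i).choose i → IsSumTwoPow (d * i) := by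
  have hcoeff (k : ℕ) : (EE F n d).coeff k =
      ∑ i ∈ Finset.Icc 1 (n / 2), if k = d * i then (-1 : F) ^ i * ((n - i).choose i : F) else 0 := by
    simp only [EE, finsetSum_coeff, coeff_C_mul_X_pow]
  constructor
  · intro h i hi1 hi2 hi3
    refine h (d * i) ?_
    rw [mem_support_iff, hcoeff, Finset.sum_eq_single i]
    · simpa [CharP.cast_eq_zero_iff F 3] using hi3
    · intro j _ hj
      rw [if_neg]
      exact fun h => hj (Nat.eq_of_mul_eq_mul_left hd h).symm
    · intro hi
      simp only [Finset.mem_Icc] at hi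
      omega
  · intro h k hk
    rw [mem_support_iff, hcoeff] at hk
    obtain ⟨i, hi, hne⟩ := Finset.exists_ne_zero_of_sum_ne_zero hk
    rw [Finset.mem_Icc] at hi
    split_ifs at hne with hki
    · subst hki
      refine h i hi.1 (by omega) fun hdvd => hne ?_
      rw [(CharP.cast_eq_zero_iff F 3 _).2 hdvd, mul_zero]
    · exact absurd rfl hne

theorem forall_isSumTwoPow_mul_pow {n c : ℕ} (hn : n < 20)
    (h : ∀ i < 10, Occurs n i → ∃ s < 4, ∃ t < 4, c * i = 3 ^ s + 3 ^ t) (k i : ℕ)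
    (hi1 : 1 ≤ i) (hi2 : 2 * i ≤ n) (hi3 : ¬ 3 ∣ (n - i).choose i) :
    IsSumTwoPow (c * 3 ^ k * i) := by
  rw [three_dvd_choose_iff (by omega)] at hi3
  rw [mul_right_comm]
  obtain ⟨s, -, t, -, hst⟩ := h i (by omega) ⟨hi1, hi2, hi3⟩
  exact IsSumTwoPow.mul_pow ⟨s, t, hst⟩ k

theorem two_dvd_three_pow_add_one (a : ℕ) : 2 ∣ 3 ^ a + 1 := by
  have : Odd (3 ^ a) := Odd.pow (by decide)
  exact (this.add_one).two_dvd

theorem stmt1 {F : Type*} [Field F] [Fintype F] (e : ℕ) (he : 0 < e)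
    (hcard : Fintype.card F = 3 ^ e) (n d : ℕ) (hn : 2 ≤ n) (hd : 1 ≤ d) :
    IsDOPoly 3 (EE F n d) ↔
      ((n = 2 ∨ n = 3 ∨ n = 5 ∨ n = 6) ∧ ∃ α k : ℕ, d = (3 ^ α + 1) * 3 ^ k) ∨
      (n = 4 ∧ ∃ α k : ℕ, d = (3 ^ α + 1) / 2 * 3 ^ k) ∨
      (n = 7 ∧ ∃ k : ℕ, d = 2 * 3 ^ k) ∨
      (n = 10 ∧ ∃ k : ℕ, d = 2 * 3 ^ k) ∨
      (n = 13 ∧ ∃ k : ℕ, d = 2 * 3 ^ k) ∨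
      (n = 15 ∧ ∃ k : ℕ, d = 4 * 3 ^ k) ∨
      (n = 19 ∧ ∃ k : ℕ, d = 2 * 3 ^ k) := by
  have : Fact (Nat.Prime 3) := ⟨Nat.prime_three⟩
  have : CharP F 3 := charP_of_card_eq_prime_pow hcard
  rw [isDOPoly_EE_iff hd]
  constructor
  · intro H
    obtain ⟨k, c, hc, rfl⟩ := Nat.exists_eq_pow_mul_and_not_dvd (n := d) (by omega) 3 (by norm_num)
    replace H : ∀ i < 27, Occurs n i → IsSumTwoPow (c * i) := by
      rintro i hi ⟨hi1, hi2, hi3⟩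
      have := H i hi1 hi2 (by rwa [three_dvd_choose_iff hi])
      rwa [mul_comm (3 ^ k), mul_right_comm, isSumTwoPow_mul_pow] at this
    have h1 : Occurs n 1 → IsSumTwoPow c := fun h => by simpa using H 1 (by norm_num) h
    have h3 : Occurs n 3 → IsSumTwoPow c := fun h => (H 3 (by norm_num) h).of_mul_three
    have hlarge : 7 ≤ n → n = 7 ∨ n = 10 ∨ n = 13 ∨ n = 15 ∨ n = 19 := by
      intro h7
      by_contra! hne
      obtain ⟨l, hl, hl'⟩ :=
        exists_obstruction h7 hne.1 hne.2.1 hne.2.2.1 hne.2.2.2.1 hne.2.2.2.2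
      exact not_forall_isSumTwoPow_of_mem_obstructions hc hl
        fun i hi => H i (lt_of_mem_obstructions l hl i hi) (hl' i hi)
    have hcases : n = 2 ∨ n = 3 ∨ n = 4 ∨ n = 5 ∨ n = 6 ∨
        n = 7 ∨ n = 10 ∨ n = 13 ∨ n = 15 ∨ n = 19 := by omega
    have hsmall (h : Occurs n 1) : ∃ α k' : ℕ, 3 ^ k * c = (3 ^ α + 1) * 3 ^ k' := by
      obtain ⟨a, rfl⟩ := (h1 h).exists_eq_add_one hc
      exact ⟨a, k, mul_comm _ _⟩
    have htwo (h : c = 2) : ∃ k' : ℕ, 3 ^ k * c = 2 * 3 ^ k' := ⟨k, by rw [h, mul_comm]⟩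
    rcases hcases with rfl | rfl | rfl | rfl | rfl | rfl | rfl | rfl | rfl | rfl
    · exact Or.inl ⟨by simp, hsmall (by decide)⟩
    · exact Or.inl ⟨by simp, hsmall (by decide)⟩
    · obtain ⟨a, ha⟩ := (H 2 (by norm_num) (by decide)).exists_eq_add_one (by omega)
      refine Or.inr (Or.inl ⟨rfl, a, k, ?_⟩)
      rw [← ha, Nat.mul_div_cancel _ (by norm_num), mul_comm]
    · exact Or.inl ⟨by simp, hsmall (by decide)⟩
    · exact Or.inl ⟨by simp, hsmall (by decide)⟩
    · have := htwo (eq_two_of_isSumTwoPow hc (h3 (by decide)) (H 2 (by norm_num) (by decide)))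
      simpa using this
    · have := htwo (eq_two_of_isSumTwoPow hc (h3 (by decide)) (H 2 (by norm_num) (by decide)))
      simpa using this
    · have := htwo (eq_two_of_isSumTwoPow_two_five hc (H 2 (by norm_num) (by decide))
        (H 5 (by norm_num) (by decide)))
      simpa using this
    · have := eq_four_of_isSumTwoPow hc (h1 (by decide)) (H 7 (by norm_num) (by decide))
      simpa using ⟨k, by rw [this, mul_comm]⟩
    · have := htwo (eq_two_of_isSumTwoPow hc (h3 (by decide)) (H 2 (by norm_num) (by decide)))
      simpa using this
  · rintro (⟨hn', a, k, rfl⟩ | ⟨rfl, a, k, rfl⟩ | ⟨rfl, k, rfl⟩ | ⟨rfl, k, rfl⟩ | ⟨rfl, k, rfl⟩ |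
      ⟨rfl, k, rfl⟩ | ⟨rfl, k, rfl⟩)
    · intro i hi1 hi2 hi3
      have hi : i = 1 ∨ i = 3 := by
        have hi' : i ≤ 3 := by omega
        rcases hn' with rfl | rfl | rfl | rfl <;> interval_cases i <;> simp_all [Nat.choose]
      rcases hi with rfl | rfl
      · exact ⟨a + k, k, by ring⟩
      · exact ⟨a + k + 1, k + 1, by ring⟩
    · intro i hi1 hi2 hi3
      have hi : i = 2 := by
        have hi' : i ≤ 2 := by omega
        interval_cases i <;> simp_all
      rw [hi, mul_right_comm, Nat.div_mul_cancel (two_dvd_three_pow_add_one a)]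
      exact ⟨a + k, k, by ring⟩
    all_goals
      exact forall_isSumTwoPow_mul_pow (by norm_num) (by decide +kernel) k
end

section
/- Let p > 5 be a prime, let q be a power of p, and let n ≥ 2 and d ≥ 1 be integers. The polynomial 𝖤_{n,d} ∈ 𝔽_q[x] is a Dembowski–Ostrom polynomial if and only if n ∈ {2, 3} and d = p^k·(p^α + 1) for some integers α, k ≥ 0. -/
open Polynomial Finset

/-- The coefficient of `x^{d·i}` in `𝖤_{n,d}`. -/
lemma coeff_EE (F : Type*) [Field F] {n d i : ℕ} (hd : 1 ≤ d) (hi : i ∈ Finset.Icc 1 (n / 2)) :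
    (EE F n d).coeff (d * i) = (-1 : F) ^ i * ((n - i).choose i : F) := by
  unfold EE
  rw [finsetSum_coeff, Finset.sum_eq_single_of_mem i hi]
  · rw [coeff_C_mul_X_pow, if_pos rfl]
  · intro j _ hji
    rw [coeff_C_mul_X_pow, if_neg]
    intro h
    exact hji (Nat.eq_of_mul_eq_mul_left hd h).symm

/-- A prime not dividing any factor of the falling factorial does not divide the binomial
coefficient. -/
lemma Nat.Prime.not_dvd_choose_of_forall {p m i : ℕ} (hp : p.Prime)
    (h : ∀ j < i, ¬ p ∣ m - j) : ¬ p ∣ m.choose i := by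
  intro hdvd
  have h1 : p ∣ m.descFactorial i := by
    rw [Nat.descFactorial_eq_factorial_mul_choose]
    exact hdvd.mul_left _
  rw [Nat.descFactorial_eq_prod_range, hp.prime.dvd_finsetProd_iff] at h1
  obtain ⟨j, hj, hj'⟩ := h1
  exact h j (Finset.mem_range.mp hj) hj'

/-- If `𝖤_{n,d}` is a DO polynomial, exponents with nonzero coefficient modulo `p` are sums of two
powers of `p`. -/
lemma IsDOPoly.exists_eq_of_not_dvd {F : Type*} [Field F] {p n d i : ℕ} [CharP F p]
    (hp : p.Prime) (hd : 1 ≤ d) (h : IsDOPoly p (EE F n d)) (hi : 1 ≤ i) (hin : 2 * i ≤ n)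
    (hfac : ∀ j < i, ¬ p ∣ n - i - j) : ∃ a b : ℕ, d * i = p ^ a + p ^ b := by
  apply h
  rw [mem_support_iff, coeff_EE F hd (Finset.mem_Icc.mpr ⟨hi, by omega⟩)]
  refine mul_ne_zero (pow_ne_zero _ (neg_ne_zero.mpr one_ne_zero)) ?_
  rw [Ne, CharP.cast_eq_zero_iff F p]
  exact hp.not_dvd_choose_of_forall hfac

/-- If a number and its `m`-fold multiple are both sums of two powers of `p`, then
`p - 1` divides `2 (m - 1)`. -/
lemma sub_one_dvd_of_mul_eq {p m a b c e : ℕ} (hp : 1 ≤ p) (hm : 1 ≤ m)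
    (h : (p ^ a + p ^ b) * m = p ^ c + p ^ e) : p - 1 ∣ 2 * (m - 1) := by
  have key (k : ℕ) : p ^ k ≡ 1 [MOD p - 1] := by
    have h1 : p ≡ 1 [MOD p - 1] := ((Nat.modEq_iff_dvd' hp).mpr dvd_rfl).symm
    simpa using h1.pow k
  have h2 : (1 + 1) * m ≡ 1 + 1 [MOD p - 1] :=
    ((((key a).add (key b)).mul_right m).symm.trans (by rw [h])).trans ((key c).add (key e))
  have h3 := (Nat.modEq_iff_dvd' (by omega)).mp h2.symm
  convert h3 using 1
  omega

/-- For a prime `p > 5` and `m ∈ {2, 3, 5}`, a number and its `m`-fold multiple cannot both be sums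
of two powers of `p`. -/
lemma not_mul_eq_sum_two_pow {p m x : ℕ} (hp : p.Prime) (hp5 : 5 < p)
    (hm : m = 2 ∨ m = 3 ∨ m = 5) (hx : ∃ a b : ℕ, x = p ^ a + p ^ b)
    (hmx : ∃ c e : ℕ, x * m = p ^ c + p ^ e) : False := by
  obtain ⟨a, b, rfl⟩ := hx
  obtain ⟨c, e, h⟩ := hmx
  have hdvd := sub_one_dvd_of_mul_eq hp.one_le (by omega) h
  have hle := Nat.le_of_dvd (by omega) hdvd
  have hp9 : p ≤ 9 := by omega
  interval_cases p <;> rcases hm with rfl | rfl | rfl <;> revert hp hdvd <;> norm_num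

/-- If `n ≡ r` modulo `p` and `r < k < r + p ≤ n + p`, then `p` does not divide `n - k`. -/
lemma not_dvd_sub_of_dvd_sub {p n r k : ℕ} (hr : p ∣ n - r) (hrk : r < k) (hkn : k ≤ n)
    (hkp : k < r + p) : ¬ p ∣ n - k := by
  intro h
  have h1 := Nat.dvd_sub hr h
  have h2 := Nat.le_of_dvd (by omega) h1
  omega

theorem stmt3 {F : Type*} [Field F] [Fintype F] (p e : ℕ) (hp : p.Prime)
    (hp5 : 5 < p) (he : 0 < e) (hcard : Fintype.card F = p ^ e)
    (n d : ℕ) (hn : 2 ≤ n) (hd : 1 ≤ d) :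
    IsDOPoly p (EE F n d) ↔
      (n = 2 ∨ n = 3) ∧ ∃ α k : ℕ, d = p ^ k * (p ^ α + 1) := by
  have : Fact p.Prime := ⟨hp⟩
  have : CharP F p := charP_of_card_eq_prime_pow hcard
  have hp7 : 7 ≤ p := by
    rcases (by omega : p = 6 ∨ 7 ≤ p) with rfl | h
    · revert hp; norm_num
    · exact h
  constructor
  · intro h
    have hn23 : n = 2 ∨ n = 3 := by
      by_contra hne
      have hn4 : 4 ≤ n := by omega
      by_cases h1 : p ∣ n - 1
      · have hpn := Nat.le_of_dvd (by omega) h1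
        have e2 := h.exists_eq_of_not_dvd (i := 2) hp hd (by omega) (by omega) fun j hj => by
          rw [Nat.sub_sub]
          exact not_dvd_sub_of_dvd_sub h1 (by omega) (by omega) (by omega)
        have e4 := h.exists_eq_of_not_dvd (i := 4) hp hd (by omega) (by omega) fun j hj => by
          rw [Nat.sub_sub]
          exact not_dvd_sub_of_dvd_sub h1 (by omega) (by omega) (by omega)
        exact not_mul_eq_sum_two_pow hp hp5 (m := 2) (by simp) e2 (by rwa [mul_assoc])
      have e1 : ∃ a b : ℕ, d = p ^ a + p ^ b := by
        simpa using h.exists_eq_of_not_dvd (i := 1) hp hd le_rfl (by omega) fun j hj => by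
          obtain rfl : j = 0 := by omega
          exact h1
      by_cases h2 : p ∣ n - 2
      · have hpn := Nat.le_of_dvd (by omega) h2
        have e3 := h.exists_eq_of_not_dvd (i := 3) hp hd (by omega) (by omega) fun j hj => by
          rw [Nat.sub_sub]
          exact not_dvd_sub_of_dvd_sub h2 (by omega) (by omega) (by omega)
        exact not_mul_eq_sum_two_pow hp hp5 (by simp) e1 e3
      by_cases h3 : p ∣ n - 3
      · have hpn := Nat.le_of_dvd (by omega) h3
        have e5 := h.exists_eq_of_not_dvd (i := 5) hp hd (by omega) (by omega) fun j hj => by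
          rw [Nat.sub_sub]
          exact not_dvd_sub_of_dvd_sub h3 (by omega) (by omega) (by omega)
        exact not_mul_eq_sum_two_pow hp hp5 (by simp) e1 e5
      have e2 := h.exists_eq_of_not_dvd (i := 2) hp hd (by omega) (by omega) fun j hj => by
        rw [Nat.sub_sub]
        interval_cases j
        exacts [h2, h3]
      exact not_mul_eq_sum_two_pow hp hp5 (by simp) e1 e2
    refine ⟨hn23, ?_⟩
    obtain ⟨a, b, hab⟩ := h.exists_eq_of_not_dvd (i := 1) hp hd le_rfl (by omega) fun j hj hdvd => by
      have := Nat.le_of_dvd (by omega) hdvd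
      omega
    rw [mul_one] at hab
    rcases le_total a b with hle | hle
    · refine ⟨b - a, a, ?_⟩
      rw [hab, mul_add, ← pow_add, Nat.add_sub_cancel' hle, mul_one, add_comm]
    · refine ⟨a - b, b, ?_⟩
      rw [hab, mul_add, ← pow_add, Nat.add_sub_cancel' hle, mul_one]
  · rintro ⟨hn23, α, k, hdk⟩ m hm
    have hdiv : n / 2 = 1 := by omega
    rw [EE, hdiv, Finset.Icc_self, Finset.sum_singleton, mul_one] at hm
    have hmd : m = d := by
      rw [mem_support_iff, coeff_C_mul_X_pow] at hm
      by_contra hne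
      exact hm (if_neg hne)
    exact ⟨k + α, k, by rw [hmd, hdk, mul_add, pow_add, mul_one]⟩
end

section
/- Let q be a power of 3 and let j, ℓ, m ≥ 0 be integers. For n = 2·3^m and d = (3^j + 1)·3^ℓ, one has 𝒟_{n,d} = x^{3^{ℓ+m+j} + 3^{ℓ+m}} in 𝔽_q[x]; in particular 𝒟_{n,d} is a Dembowski–Ostrom polynomial. -/
open Polynomial Finset

theorem dicksonCoeff_add_succ (a k : ℕ) :
    dicksonCoeff (a + 1 + (k + 1)) (k + 1) = (a + 1).choose (k + 1) + a.choose k := by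
  have h := Nat.add_one_mul_choose_eq a k
  unfold dicksonCoeff
  rw [Nat.add_sub_cancel]
  refine Nat.div_eq_of_eq_mul_right a.succ_pos ?_
  linear_combination -h

theorem succ_mul_dicksonCoeff_add_succ (a k : ℕ) :
    (k + 1) * dicksonCoeff (a + 1 + (k + 1)) (k + 1) = (a + 1 + (k + 1)) * a.choose k := by
  rw [dicksonCoeff_add_succ]
  linear_combination -Nat.add_one_mul_choose_eq a k

theorem dvd_mul_dicksonCoeff {n i : ℕ} (hi : 0 < i) (hin : i < n) : n ∣ i * dicksonCoeff n i := by
  obtain ⟨k, rfl⟩ := Nat.exists_eq_add_one.mpr hi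
  obtain ⟨a, rfl⟩ : ∃ a, n = a + 1 + (k + 1) := ⟨n - (k + 1) - 1, by omega⟩
  exact ⟨a.choose k, succ_mul_dicksonCoeff_add_succ a k⟩

theorem prime_dvd_dicksonCoeff {p n m i : ℕ} (hp : p.Prime) (hn : p ^ m ∣ n) (hi : 0 < i)
    (him : i < p ^ m) (hin : i < n) : p ∣ dicksonCoeff n i := by
  by_contra h
  have hcop : (p ^ m).Coprime (dicksonCoeff n i) := ((hp.coprime_iff_not_dvd).mpr h).pow_left m
  exact him.not_ge (Nat.le_of_dvd hi
    (hcop.dvd_of_dvd_mul_right (hn.trans (dvd_mul_dicksonCoeff hi hin))))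

theorem dicksonCoeff_two_mul_self {k : ℕ} (hk : 0 < k) : dicksonCoeff (2 * k) k = 2 := by
  have h : 2 * k - k = k := by omega
  simp [dicksonCoeff, h, hk]

theorem DD_two_mul_prime_pow {F : Type*} [Field F] {p : ℕ} [CharP F p] (hp : p.Prime)
    (hodd : Odd p) (m d : ℕ) : DD F (2 * p ^ m) d = C (-2) * X ^ (d * p ^ m) := by
  have hpos : 0 < p ^ m := pow_pos hp.pos m
  rw [DD, Nat.mul_div_cancel_left _ two_pos, Finset.sum_eq_single_of_mem (p ^ m)
    (Finset.mem_Icc.mpr ⟨hpos, le_rfl⟩), dicksonCoeff_two_mul_self hpos, hodd.pow.neg_one_pow]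
  · simp
  · intro i hi hne
    rw [Finset.mem_Icc] at hi
    have hdvd : p ∣ dicksonCoeff (2 * p ^ m) i :=
      prime_dvd_dicksonCoeff hp (dvd_mul_left _ _) hi.1 (by omega) (by omega)
    simp [(CharP.cast_eq_zero_iff F p _).mpr hdvd]

theorem isDOPoly_X_pow {F : Type*} [Field F] (p i j : ℕ) :
    IsDOPoly p (X ^ (p ^ i + p ^ j) : F[X]) := fun k hk =>
  ⟨i, j, by simpa [support_X_pow] using hk⟩

theorem stmt7 {F : Type*} [Field F] [Fintype F] (e : ℕ) (he : 0 < e)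
    (hcard : Fintype.card F = 3 ^ e) (j l m : ℕ) :
    DD F (2 * 3 ^ m) ((3 ^ j + 1) * 3 ^ l) = X ^ (3 ^ (l + m + j) + 3 ^ (l + m)) ∧
      IsDOPoly 3 (DD F (2 * 3 ^ m) ((3 ^ j + 1) * 3 ^ l)) := by
  have : CharP F 3 :=
    have : Fact (Nat.Prime 3) := ⟨Nat.prime_three⟩
    charP_of_card_eq_prime_pow hcard
  have hneg : (-2 : F) = 1 := by
    have h3 : (3 : F) = 0 := by exact_mod_cast CharP.cast_eq_zero F 3
    linear_combination -h3
  have hDD : DD F (2 * 3 ^ m) ((3 ^ j + 1) * 3 ^ l) = X ^ (3 ^ (l + m + j) + 3 ^ (l + m)) := by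
    rw [DD_two_mul_prime_pow Nat.prime_three (by decide), hneg, C_1, one_mul]
    congr 1
    ring
  exact ⟨hDD, hDD ▸ isDOPoly_X_pow 3 _ _⟩
end

section
/- Let q be a power of 3 and let ℓ, m ≥ 0 be integers. For n = 5·3^m and d = 2·3^ℓ, one has 𝒟_{n,d} = x^{2·3^{ℓ+m}} + 2·x^{4·3^{ℓ+m}} in 𝔽_q[x]; in particular 𝒟_{n,d} is a Dembowski–Ostrom polynomial. -/
open Polynomial Finset

theorem dicksonCoeff_zero_right {n : ℕ} (hn : 0 < n) : dicksonCoeff n 0 = 1 := by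
  simp [dicksonCoeff, Nat.div_self hn]

theorem dicksonCoeff_eq_zero {n i : ℕ} (h : n < 2 * i) : dicksonCoeff n i = 0 := by
  simp [dicksonCoeff, Nat.choose_eq_zero_of_lt (show n - i < i by omega)]

theorem dicksonCoeff_add_two (i k : ℕ) :
    dicksonCoeff (i + 2 + k) (i + 1) = (k + 1).choose (i + 1) + k.choose i := by
  have hsub : i + 2 + k - (i + 1) = k + 1 := by omega
  rw [dicksonCoeff, hsub]
  refine Nat.div_eq_of_eq_mul_right k.succ_pos ?_
  linear_combination -Nat.add_one_mul_choose_eq k i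

theorem dicksonCoeff_recurrence {n : ℕ} (hn : 0 < n) (i : ℕ) :
    dicksonCoeff (n + 2) (i + 1) = dicksonCoeff (n + 1) (i + 1) + dicksonCoeff n i := by
  rcases Nat.lt_or_ge i n with h | h
  · obtain ⟨k, rfl⟩ := Nat.exists_eq_add_of_lt h
    rw [show i + k + 1 + 2 = i + 2 + (k + 1) by ring, show i + k + 1 + 1 = i + 2 + k by ring,
      dicksonCoeff_add_two, dicksonCoeff_add_two]
    cases i with
    | zero => rw [dicksonCoeff_zero_right hn]; simp
    | succ j =>
      rw [show j + 1 + k + 1 = j + 2 + k by ring, dicksonCoeff_add_two]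
      have h₁ := Nat.choose_succ_succ (k + 1) (j + 1)
      have h₂ := Nat.choose_succ_succ k j
      simp only [Nat.succ_eq_add_one] at *
      omega
  · rw [dicksonCoeff_eq_zero (by omega), dicksonCoeff_eq_zero (by omega),
      dicksonCoeff_eq_zero (by omega)]

/-- The companion matrix of `t ^ 2 - t + y`; the trace of its `n`-th power is `D_n(1, y)`. -/
def dicksonMatrix {R : Type*} [CommRing R] (y : R) : Matrix (Fin 2) (Fin 2) R :=
  !![1, -y; 1, 0]

theorem dicksonMatrix_sq {R : Type*} [CommRing R] (y : R) :
    dicksonMatrix y ^ 2 = dicksonMatrix y - y • (1 : Matrix (Fin 2) (Fin 2) R) := by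
  ext i j
  fin_cases i <;> fin_cases j <;>
    simp [dicksonMatrix, pow_two, Matrix.mul_apply, Fin.sum_univ_two, sub_eq_add_neg]

theorem trace_dicksonMatrix_pow_add_two {R : Type*} [CommRing R] (y : R) (n : ℕ) :
    (dicksonMatrix y ^ (n + 2)).trace =
      (dicksonMatrix y ^ (n + 1)).trace - y * (dicksonMatrix y ^ n).trace := by
  rw [pow_add, dicksonMatrix_sq, mul_sub, ← pow_succ, Matrix.trace_sub, mul_smul_comm, mul_one,
    Matrix.trace_smul, smul_eq_mul]

theorem trace_dicksonMatrix_pow_one {R : Type*} [CommRing R] (y : R) :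
    (dicksonMatrix y ^ 1).trace = 1 := by
  simp [dicksonMatrix, Matrix.trace_fin_two]

theorem trace_dicksonMatrix_pow_two {R : Type*} [CommRing R] (y : R) :
    (dicksonMatrix y ^ 2).trace = 1 - 2 * y := by
  have h := trace_dicksonMatrix_pow_add_two y 0
  rw [zero_add, zero_add, trace_dicksonMatrix_pow_one, pow_zero, Matrix.trace_one] at h
  rw [h, Fintype.card_fin]
  push_cast
  ring

theorem sum_dicksonCoeff_eq_trace {R : Type*} [CommRing R] (y : R) (n : ℕ) :
    ∀ N, n + 1 < 2 * N →
      ∑ i ∈ Finset.range N, (-y) ^ i * (dicksonCoeff (n + 1) i : R) =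
        (dicksonMatrix y ^ (n + 1)).trace := by
  induction n using Nat.twoStepInduction with
  | zero =>
    rintro (_ | N) hN
    · omega
    rw [Finset.sum_range_succ', trace_dicksonMatrix_pow_one, Finset.sum_eq_zero,
      dicksonCoeff_zero_right (by omega)]
    · simp
    · intro i _
      rw [dicksonCoeff_eq_zero (by omega)]
      simp
  | one =>
    rintro (_ | _ | N) hN
    · omega
    · omega
    rw [Finset.sum_range_succ', Finset.sum_range_succ', trace_dicksonMatrix_pow_two,
      Finset.sum_eq_zero, dicksonCoeff_zero_right (by omega)]
    · simp [dicksonCoeff]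
      ring
    · intro i _
      rw [dicksonCoeff_eq_zero (by omega)]
      simp
  | more n ih₀ ih₁ =>
    rintro (_ | N) hN
    · omega
    rw [trace_dicksonMatrix_pow_add_two, ← ih₀ N (by omega), ← ih₁ (N + 1) (by omega),
      Finset.sum_range_succ', Finset.sum_range_succ', dicksonCoeff_zero_right (by omega),
      dicksonCoeff_zero_right (by omega), Finset.mul_sum, add_sub_right_comm,
      ← Finset.sum_sub_distrib]
    congr 1
    refine Finset.sum_congr rfl fun i _ => ?_
    rw [dicksonCoeff_recurrence n.succ_pos]
    push_cast
    ring

theorem trace_pow_three_of_charP_three {R : Type*} [CommRing R] [CharP R 3]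
    (M : Matrix (Fin 2) (Fin 2) R) : (M ^ 3).trace = M.trace ^ 3 := by
  have h3 : (3 : R) = 0 := by exact_mod_cast CharP.cast_eq_zero R 3
  simp only [pow_succ, pow_zero, one_mul, Matrix.trace_fin_two, Matrix.mul_apply,
    Fin.sum_univ_two]
  linear_combination
    ((M 0 0 + M 1 1) * (M 0 1 * M 1 0 - M 0 0 * M 1 1)) * h3

theorem trace_pow_three_pow_of_charP_three {R : Type*} [CommRing R] [CharP R 3]
    (M : Matrix (Fin 2) (Fin 2) R) (m : ℕ) : (M ^ 3 ^ m).trace = M.trace ^ 3 ^ m := by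
  induction m with
  | zero => simp
  | succ m ih => rw [pow_succ, pow_mul, trace_pow_three_of_charP_three, ih, ← pow_mul]

theorem one_add_DD {F : Type*} [Field F] {n : ℕ} (hn : 0 < n) (d : ℕ) :
    1 + DD F n d = (dicksonMatrix (X ^ d : F[X]) ^ n).trace := by
  obtain ⟨n, rfl⟩ := Nat.exists_eq_add_one_of_ne_zero hn.ne'
  rw [← sum_dicksonCoeff_eq_trace (X ^ d : F[X]) n ((n + 1) / 2 + 1) (by omega),
    Finset.range_eq_Ico, Finset.sum_eq_sum_Ico_succ_bot (by omega),
    dicksonCoeff_zero_right hn, DD]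
  congr 1
  · simp
  · refine Finset.sum_congr (by ext; simp) fun i _ => ?_
    rw [neg_pow (X ^ d : F[X]), pow_mul]
    simp only [map_mul, map_pow, map_neg, map_one, map_natCast]
    ring

theorem trace_dicksonMatrix_pow_five {R : Type*} [CommRing R] (y : R) :
    (dicksonMatrix y ^ 5).trace = 1 - 5 * y + 5 * y ^ 2 := by
  have h₃ := trace_dicksonMatrix_pow_add_two y 1
  have h₄ := trace_dicksonMatrix_pow_add_two y 2
  have h₅ := trace_dicksonMatrix_pow_add_two y 3
  norm_num only [trace_dicksonMatrix_pow_one, trace_dicksonMatrix_pow_two] at h₃ h₄ h₅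
  rw [h₅, h₄, h₃]
  ring

theorem DD_five_mul_three_pow {F : Type*} [Field F] [CharP F 3] (l m : ℕ) :
    DD F (5 * 3 ^ m) (2 * 3 ^ l) =
      X ^ (2 * 3 ^ (l + m)) + C (2 : F) * X ^ (4 * 3 ^ (l + m)) := by
  have : Fact (Nat.Prime 3) := ⟨Nat.prime_three⟩
  have h3 : (3 : F[X]) = 0 := by exact_mod_cast CharP.cast_eq_zero F[X] 3
  have key := one_add_DD (F := F) (n := 5 * 3 ^ m) (by positivity) (2 * 3 ^ l)
  have hfive (y : F[X]) : 1 - 5 * y + 5 * y ^ 2 = 1 + y - y ^ 2 := by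
    linear_combination (2 * y ^ 2 - 2 * y) * h3
  rw [pow_mul, trace_pow_three_pow_of_charP_three, trace_dicksonMatrix_pow_five, hfive,
    sub_pow_char_pow, add_pow_char_pow, one_pow, ← pow_mul, ← pow_mul, ← pow_mul,
    show 2 * 3 ^ l * 3 ^ m = 2 * 3 ^ (l + m) by ring,
    show 2 * 3 ^ l * (2 * 3 ^ m) = 4 * 3 ^ (l + m) by ring] at key
  rw [C_ofNat]
  linear_combination key - X ^ (4 * 3 ^ (l + m)) * h3

theorem isDOPoly_three_X_pow_add {F : Type*} [Field F] (k : ℕ) (c : F) :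
    IsDOPoly 3 (X ^ (2 * 3 ^ k) + C c * X ^ (4 * 3 ^ k) : F[X]) := by
  intro j hj
  rw [mem_support_iff, coeff_add, coeff_X_pow, coeff_C_mul_X_pow] at hj
  by_cases h₂ : j = 2 * 3 ^ k
  · exact ⟨k, k, by omega⟩
  by_cases h₄ : j = 4 * 3 ^ k
  · exact ⟨k, k + 1, by rw [h₄]; ring⟩
  simp [h₂, h₄] at hj

theorem stmt9 {F : Type*} [Field F] [Fintype F] (e : ℕ) (he : 0 < e)
    (hcard : Fintype.card F = 3 ^ e) (l m : ℕ) :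
    DD F (5 * 3 ^ m) (2 * 3 ^ l) =
        X ^ (2 * 3 ^ (l + m)) + C (2 : F) * X ^ (4 * 3 ^ (l + m)) ∧
      IsDOPoly 3 (DD F (5 * 3 ^ m) (2 * 3 ^ l)) := by
  have : Fact (Nat.Prime 3) := ⟨Nat.prime_three⟩
  have : CharP F 3 := charP_of_card_eq_prime_pow hcard
  rw [DD_five_mul_three_pow]
  exact ⟨rfl, isDOPoly_three_X_pow_add _ _⟩
end

section
/- Let q be a power of 3 and let k ≥ 0 be an integer. For n = 13 and d = 2·3^k, one has 𝖤_{13,d} = x^{4·3^k} + x^{10·3^k} + x^{12·3^k} in 𝔽_q[x]; in particular 𝖤_{13,d} is a Dembowski–Ostrom polynomial. -/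
open Polynomial Finset

/-- If `3 = 0` in `F`, then `𝖤_{13,2m} = x^{4m} + x^{10m} + x^{12m}`. -/
theorem EE_thirteen_of_three_eq_zero {F : Type*} [Field F] (h3 : (3 : F) = 0) (m : ℕ) :
    EE F 13 (2 * m) = X ^ (4 * m) + X ^ (10 * m) + X ^ (12 * m) := by
  have hC : (3 : F[X]) = 0 := by rw [← map_ofNat C 3, h3, map_zero]
  have hchoose : Nat.choose 12 1 = 12 ∧ Nat.choose 11 2 = 55 ∧ Nat.choose 10 3 = 120 ∧
      Nat.choose 9 4 = 126 ∧ Nat.choose 8 5 = 56 ∧ Nat.choose 7 6 = 7 := by decide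
  obtain ⟨e1, e2, e3, e4, e5, e6⟩ := hchoose
  have hIcc : Finset.Icc 1 (13 / 2) = {1, 2, 3, 4, 5, 6} := by decide
  rw [EE, hIcc]
  simp only [Finset.sum_insert, Finset.sum_singleton, Finset.mem_insert, Finset.mem_singleton,
    Nat.reduceEqDiff, OfNat.one_ne_ofNat, or_self, not_false_eq_true, Nat.reduceSub,
    e1, e2, e3, e4, e5, e6,
    map_mul, map_pow, map_neg, map_one, map_natCast, Nat.cast_ofNat]
  linear_combination (-4 * X ^ (2 * m) + 18 * X ^ (4 * m) - 40 * X ^ (6 * m) +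
    42 * X ^ (8 * m) - 19 * X ^ (10 * m) + 2 * X ^ (12 * m)) * hC

theorem stmt14 {F : Type*} [Field F] [Fintype F] (e : ℕ) (he : 0 < e)
    (hcard : Fintype.card F = 3 ^ e) (k : ℕ) :
    EE F 13 (2 * 3 ^ k) =
        X ^ (4 * 3 ^ k) + X ^ (10 * 3 ^ k) + X ^ (12 * 3 ^ k) ∧
      IsDOPoly 3 (EE F 13 (2 * 3 ^ k)) := by
  have h3 : (3 : F) = 0 := by
    have h := Nat.cast_card_eq_zero F
    rw [hcard] at h
    exact (pow_eq_zero_iff he.ne').mp (by simpa using h)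
  have hEE := EE_thirteen_of_three_eq_zero h3 (3 ^ k)
  refine ⟨hEE, fun a ha => ?_⟩
  have hcases : a = 4 * 3 ^ k ∨ a = 10 * 3 ^ k ∨ a = 12 * 3 ^ k := by
    by_contra! hne
    rw [hEE, mem_support_iff] at ha
    simp [coeff_X_pow, hne] at ha
  obtain rfl | rfl | rfl := hcases
  · exact ⟨k + 1, k, by ring⟩
  · exact ⟨k + 2, k, by ring⟩
  · exact ⟨k + 2, k + 1, by ring⟩
end

section
/- Let q be a power of 3 and let k ≥ 0 be an integer. For n = 19 and d = 2·3^k, one has 𝖤_{19,d} = x^{4·3^k} + x^{2·3^{k+1}} + 2·x^{10·3^k} + 2·x^{2·3^{k+2}} in 𝔽_q[x]; in particular 𝖤_{19,d} is a Dembowski–Ostrom polynomial. -/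
open Polynomial Finset

/-- A field with `3 ^ e` elements has characteristic three. -/
theorem three_eq_zero_of_card {F : Type*} [Field F] [Fintype F] {e : ℕ}
    (hcard : Fintype.card F = 3 ^ e) : (3 : F) = 0 := by
  have h : ((Fintype.card F : ℕ) : F) = 0 := Nat.cast_card_eq_zero F
  rw [hcard] at h
  push_cast at h
  exact eq_zero_of_pow_eq_zero h

theorem stmt15 {F : Type*} [Field F] [Fintype F] (e : ℕ) (he : 0 < e)
    (hcard : Fintype.card F = 3 ^ e) (k : ℕ) :
    EE F 19 (2 * 3 ^ k) =
        X ^ (4 * 3 ^ k) + X ^ (2 * 3 ^ (k + 1)) + C (2 : F) * X ^ (10 * 3 ^ k) +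
          C (2 : F) * X ^ (2 * 3 ^ (k + 2)) ∧
      IsDOPoly 3 (EE F 19 (2 * 3 ^ k)) := by
  have h3 : (3 : F) = 0 := three_eq_zero_of_card hcard
  have hP : (3 : F[X]) = 0 := by
    rw [← map_ofNat (C : F →+* F[X]) 3, h3, map_zero]
  have hC : C (2 : F) = 2 := map_ofNat C 2
  have hE : EE F 19 (2 * 3 ^ k) =
      X ^ (4 * 3 ^ k) + X ^ (2 * 3 ^ (k + 1)) + C (2 : F) * X ^ (10 * 3 ^ k) +
        C (2 : F) * X ^ (2 * 3 ^ (k + 2)) := by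
    have e1 : 2 * 3 ^ (k + 1) = (2 * 3 ^ k) * 3 := by ring
    have e2 : 2 * 3 ^ (k + 2) = (2 * 3 ^ k) * 9 := by ring
    have e3 : 4 * 3 ^ k = (2 * 3 ^ k) * 2 := by ring
    have e4 : 10 * 3 ^ k = (2 * 3 ^ k) * 5 := by ring
    rw [e1, e2, e3, e4, hC]
    simp only [EE, pow_mul _ (2 * 3 ^ k)]
    generalize (X : F[X]) ^ (2 * 3 ^ k) = Y
    norm_num [Finset.sum_Icc_succ_top, Nat.choose]
    linear_combination (-6 * Y + 45 * Y ^ 2 - 187 * Y ^ 3 + 455 * Y ^ 4 - 668 * Y ^ 5 +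
      572 * Y ^ 6 - 264 * Y ^ 7 + 55 * Y ^ 8 - 4 * Y ^ 9) * hP
  refine ⟨hE, fun m hm => ?_⟩
  rw [hE, mem_support_iff] at hm
  simp only [coeff_add, coeff_C_mul, coeff_X_pow] at hm
  by_cases h1 : m = 4 * 3 ^ k
  · exact ⟨k, k + 1, by rw [h1]; ring⟩
  by_cases h2 : m = 2 * 3 ^ (k + 1)
  · exact ⟨k + 1, k + 1, by rw [h2]; ring⟩
  by_cases h4 : m = 10 * 3 ^ k
  · exact ⟨k, k + 2, by rw [h4]; ring⟩
  by_cases h5 : m = 2 * 3 ^ (k + 2)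
  · exact ⟨k + 2, k + 2, by rw [h5]; ring⟩
  simp [h1, h2, h4, h5] at hm
end

section
/- Let α, i be nonnegative integers. Then 7·(3^α + 1) = 3^i + 1 if and only if α = 1 and i = 3. -/
open Polynomial Finset

theorem stmt18 (α i : ℕ) :
    7 * (3 ^ α + 1) = 3 ^ i + 1 ↔ α = 1 ∧ i = 3 := by
  constructor
  · intro h
    have hi : i ≠ 0 ∧ i ≠ 1 := by
      have := Nat.one_le_pow α 3 (by norm_num)
      constructor <;> rintro rfl <;> omega
    obtain ⟨j, rfl⟩ : ∃ j, i = j + 2 := ⟨i - 2, by omega⟩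
    rw [pow_add] at h
    rcases α with _ | _ | a
    · omega
    · have hj : 3 ^ j = 3 ^ 1 := by omega
      have := Nat.pow_right_injective (by norm_num : 2 ≤ 3) hj
      omega
    · rw [add_assoc, pow_add] at h
      omega
  · rintro ⟨rfl, rfl⟩
    norm_num
end

section
/- Let n > 7 be an odd integer with 3 ∤ n, and let q be a power of 3. Then the polynomial 𝒟_{n,2} ∈ 𝔽_q[x] (i.e., the case d = 2) is not a Dembowski–Ostrom polynomial. -/
open Polynomial Finset

/-- The quotient defining `dicksonCoeff` is exact, with a division-free value. -/
theorem dicksonCoeff_succ {n i : ℕ} (h : i + 1 < n) :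
    dicksonCoeff n (i + 1) = (n - (i + 1)).choose (i + 1) + (n - (i + 2)).choose i := by
  obtain ⟨s, rfl⟩ : ∃ s, n = s + 1 + (i + 1) := ⟨n - (i + 2), by omega⟩
  have h1 : s + 1 + (i + 1) - (i + 1) = s + 1 := by omega
  have h2 : s + 1 + (i + 1) - (i + 2) = s := by omega
  have hmul := Nat.add_one_mul_choose_eq s i
  rw [dicksonCoeff, h1, h2]
  refine Nat.div_eq_of_eq_mul_right (Nat.succ_pos s) ?_
  linarith

theorem coeff_DD_two {F : Type*} [Field F] {n i : ℕ} (hi : i ∈ Finset.Icc 1 (n / 2)) :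
    (DD F n 2).coeff (2 * i) = (-1 : F) ^ i * (dicksonCoeff n i : F) := by
  simp only [DD, finsetSum_coeff, coeff_C_mul, coeff_X_pow]
  rw [Finset.sum_eq_single_of_mem i hi]
  · simp
  · intro j _ hj
    rw [if_neg (by omega), mul_zero]

/-- Lucas' theorem for the prime `3`, with the last base-`3` digits split off. -/
theorem choose_three_mul_add_modEq (a b : ℕ) {r s : ℕ} (hr : r < 3) (hs : s < 3) :
    (3 * a + r).choose (3 * b + s) ≡ r.choose s * a.choose b [MOD 3] := by
  have : Fact (Nat.Prime 3) := ⟨Nat.prime_three⟩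
  have h := Choose.choose_modEq_choose_mod_mul_choose_div_nat
    (p := 3) (n := 3 * a + r) (k := 3 * b + s)
  rwa [show (3 * a + r) % 3 = r by omega, show (3 * b + s) % 3 = s by omega,
    show (3 * a + r) / 3 = a by omega, show (3 * b + s) / 3 = b by omega] at h

/-- In characteristic `3`, the coefficient of index `3k + 1` of a reversed Dickson polynomial
of the first kind is, up to a unit, a coefficient of one of the second kind. -/
theorem three_dvd_choose_of_three_dvd_dicksonCoeff {n N k : ℕ}
    (hn : n = 3 * N + 4 ∨ n = 3 * N + 2) (hk : 2 * k ≤ N)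
    (h : 3 ∣ dicksonCoeff n (3 * k + 1)) : 3 ∣ (N - k).choose k := by
  obtain ⟨t, rfl⟩ : ∃ t, N = t + k := ⟨N - k, by omega⟩
  rw [Nat.add_sub_cancel]
  rw [dicksonCoeff_succ (by omega)] at h
  rcases hn with rfl | rfl
  · have h1 := choose_three_mul_add_modEq (t + 1) k (r := 0) (s := 1) (by omega) (by omega)
    have h2 := choose_three_mul_add_modEq t k (r := 2) (s := 0) (by omega) (by omega)
    rw [show 3 * (t + k) + 4 - (3 * k + 1) = 3 * (t + 1) + 0 by omega,
      show 3 * (t + k) + 4 - (3 * k + 2) = 3 * t + 2 by omega] at h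
    simp only [Nat.ModEq, Nat.choose_zero_right, Nat.choose_zero_succ, add_zero, one_mul,
      zero_mul] at h h1 h2
    omega
  · have h1 := choose_three_mul_add_modEq t k (r := 1) (s := 1) (by omega) (by omega)
    have h2 := choose_three_mul_add_modEq t k (r := 0) (s := 0) (by omega) (by omega)
    rw [show 3 * (t + k) + 2 - (3 * k + 1) = 3 * t + 1 by omega,
      show 3 * (t + k) + 2 - (3 * k + 2) = 3 * t by omega] at h
    simp only [Nat.ModEq, Nat.choose_self, add_zero, one_mul] at h h1 h2
    omega

/-- Modulo `3`, the reversed Dickson polynomial of the second kind of odd index at least `3`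
is not constant. -/
theorem exists_not_three_dvd_choose {N : ℕ} (hN : 3 ≤ N) (hodd : Odd N) :
    ∃ k, 1 ≤ k ∧ 2 * k ≤ N ∧ ¬ 3 ∣ (N - k).choose k := by
  obtain ⟨t, rfl⟩ := hodd
  by_cases h : 3 ∣ 2 * t
  · refine ⟨t, by omega, by omega, ?_⟩
    rw [show 2 * t + 1 - t = t + 1 by omega, Nat.choose_succ_self_right]
    omega
  · refine ⟨1, le_rfl, by omega, ?_⟩
    rwa [Nat.choose_one_right, Nat.add_sub_cancel]

theorem six_mul_add_two_ne_three_pow_add_three_pow {k : ℕ} (hk : 1 ≤ k) (i j : ℕ) :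
    2 * (3 * k + 1) ≠ 3 ^ i + 3 ^ j := by
  rcases i with _ | i <;> rcases j with _ | j <;> simp only [pow_succ, pow_zero] <;> omega

theorem stmt19 {F : Type*} [Field F] [Fintype F] (e : ℕ) (he : 0 < e)
    (hcard : Fintype.card F = 3 ^ e) (n : ℕ) (hn : 7 < n) (hodd : Odd n)
    (hnd : ¬ (3 ∣ n)) :
    ¬ IsDOPoly 3 (DD F n 2) := by
  intro hDO
  have : Fact (Nat.Prime 3) := ⟨Nat.prime_three⟩
  have : CharP F 3 := charP_of_card_eq_prime_pow hcard
  obtain ⟨N, hN, hN3, hNodd⟩ :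
      ∃ N, (n = 3 * N + 4 ∨ n = 3 * N + 2) ∧ 3 ≤ N ∧ Odd N := by
    simp only [Nat.odd_iff] at hodd ⊢
    rcases (by omega : n % 3 = 1 ∨ n % 3 = 2) with h | h
    · exact ⟨(n - 4) / 3, by omega, by omega, by omega⟩
    · exact ⟨(n - 2) / 3, by omega, by omega, by omega⟩
  obtain ⟨k, hk1, hk2, hk⟩ := exists_not_three_dvd_choose hN3 hNodd
  have hmem : 2 * (3 * k + 1) ∈ (DD F n 2).support := by
    rw [mem_support_iff, coeff_DD_two (Finset.mem_Icc.2 ⟨by omega, by omega⟩)]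
    refine mul_ne_zero (pow_ne_zero _ (neg_ne_zero.2 one_ne_zero)) fun h => hk ?_
    exact three_dvd_choose_of_three_dvd_dicksonCoeff hN hk2 ((CharP.cast_eq_zero_iff F 3 _).1 h)
  obtain ⟨i, j, hij⟩ := hDO _ hmem
  exact six_mul_add_two_ne_three_pow_add_three_pow hk1 i j hij
end
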